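/- Let (X, 𝔛) be a measurable space, (κ_i)_{i≥1} a sequence of Markov kernels from X to X, and fix a probability measure P* on X. The classical Markov process defined by (κ_i) is weakly ergodic if and only if for every set Θ and every family E = (P_θ)_{θ∈Θ} of probability measures on X, the trajectory (E_i) satisfies lim_{i→∞} Δ(E_i, E*) = 0, where E* is the constant family (Q_θ = P* for all θ ∈ Θ). -/

import Mathlib

open MeasureTheory ProbabilityTheory Filter

noncomputable section

variable {X : Type*} [MeasurableSpace X]

/-- The total variation norm `‖μ − ν‖₁` of the difference of two (finite)
measures: the sum of the masses of the positive and negative parts of the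
Jordan decomposition of `μ − ν`. -/
def tvDist (μ ν : Measure X) : ℝ :=
  ((μ - ν) Set.univ + (ν - μ) Set.univ).toReal

/-- The action `κP` of a Markov kernel on a measure: `(κP)(A) = ∫ κ(x)(A) dP(x)`. -/
def kAct (κ : Kernel X X) (μ : Measure X) : Measure X :=
  μ.bind κ

/-- The classical Markov trajectory: `E₀ = E` and `P_{θ,i} = κ_i P_{θ,i−1}`. -/
def cTraj {Θ : Type*} (κ : ℕ → Kernel X X) (E : Θ → Measure X) :
    ℕ → Θ → Measure X
  | 0 => E
  | i + 1 => fun θ => kAct (κ (i + 1)) (cTraj κ E i θ)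

/-- Iteration `κ_i ⋯ κ₂ κ₁ P` of the process on a single measure. -/
def cIter (κ : ℕ → Kernel X X) (P : Measure X) : ℕ → Measure X
  | 0 => P
  | i + 1 => kAct (κ (i + 1)) (cIter κ P i)

/-- Deficiency `δ(E,F) := inf_{Λ Markov kernel} sup_θ ‖Λ P_θ − Q_θ‖₁`. -/
def cDelta {Θ : Type*} (E F : Θ → Measure X) : ℝ :=
  ⨅ Λ : {κ : Kernel X X // IsMarkovKernel κ}, ⨆ θ : Θ, tvDist (kAct Λ.1 (E θ)) (F θ)

/-- `Δ(E,F) := max(δ(E,F), δ(F,E))`. -/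
def cDist {Θ : Type*} (E F : Θ → Measure X) : ℝ :=
  max (cDelta E F) (cDelta F E)

end

lemma tvDist_nonneg {X : Type*} [MeasurableSpace X] (μ ν : Measure X) : 0 ≤ tvDist μ ν :=
  ENNReal.toReal_nonneg

lemma tvDist_comm {X : Type*} [MeasurableSpace X] (μ ν : Measure X) :
    tvDist μ ν = tvDist ν μ := by
  rw [tvDist, tvDist, add_comm]

lemma tvDist_le_two {X : Type*} [MeasurableSpace X] (μ ν : Measure X)
    [IsProbabilityMeasure μ] [IsProbabilityMeasure ν] : tvDist μ ν ≤ 2 := by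
  refine ENNReal.toReal_le_of_le_ofReal zero_le_two ?_
  calc (μ - ν) Set.univ + (ν - μ) Set.univ ≤ μ Set.univ + ν Set.univ :=
        add_le_add (Measure.sub_le _) (Measure.sub_le _)
    _ = ENNReal.ofReal 2 := by simp [one_add_one_eq_two]

lemma measure_sub_le_sub_add_sub {X : Type*} [MeasurableSpace X] (μ ν ρ : Measure X)
    [IsFiniteMeasure μ] [IsFiniteMeasure ν] [IsFiniteMeasure ρ] :
    μ - ρ ≤ (μ - ν) + (ν - ρ) := by
  refine Measure.sub_le_of_le_add ?_
  calc μ ≤ (μ - ν) + ν := Measure.sub_le_iff_le_add.1 le_rfl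
    _ ≤ (μ - ν) + ((ν - ρ) + ρ) := add_le_add le_rfl (Measure.sub_le_iff_le_add.1 le_rfl)
    _ = (μ - ν) + (ν - ρ) + ρ := (add_assoc _ _ _).symm

lemma tvDist_triangle {X : Type*} [MeasurableSpace X] (μ ν ρ : Measure X)
    [IsFiniteMeasure μ] [IsFiniteMeasure ν] [IsFiniteMeasure ρ] :
    tvDist μ ρ ≤ tvDist μ ν + tvDist ν ρ := by
  unfold tvDist
  rw [← ENNReal.toReal_add (by finiteness) (by finiteness)]
  refine ENNReal.toReal_mono (by finiteness) ?_
  calc (μ - ρ) Set.univ + (ρ - μ) Set.univ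
      ≤ ((μ - ν) + (ν - ρ)) Set.univ + ((ρ - ν) + (ν - μ)) Set.univ :=
        add_le_add (measure_sub_le_sub_add_sub μ ν ρ _) (measure_sub_le_sub_add_sub ρ ν μ _)
    _ = _ := by simp only [Measure.add_apply]; ring

lemma cTraj_apply {X Θ : Type*} [MeasurableSpace X] (κ : ℕ → Kernel X X) (E : Θ → Measure X)
    (i : ℕ) (θ : Θ) : cTraj κ E i θ = cIter κ (E θ) i := by
  induction i with
  | zero => rfl
  | succ i ih => simp only [cTraj, cIter, ih]

lemma isProbabilityMeasure_kAct {X : Type*} [MeasurableSpace X] (κ : Kernel X X)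
    [IsMarkovKernel κ] (μ : Measure X) [IsProbabilityMeasure μ] :
    IsProbabilityMeasure (kAct κ μ) :=
  inferInstanceAs (IsProbabilityMeasure (μ.bind κ))

lemma isProbabilityMeasure_cIter {X : Type*} [MeasurableSpace X] {κ : ℕ → Kernel X X}
    (hκ : ∀ i, 1 ≤ i → IsMarkovKernel (κ i)) (P : Measure X) [hP : IsProbabilityMeasure P]
    (i : ℕ) : IsProbabilityMeasure (cIter κ P i) := by
  induction i with
  | zero => exact hP
  | succ i ih =>
    have := hκ (i + 1) (Nat.le_add_left 1 i)
    exact isProbabilityMeasure_kAct _ _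

lemma kAct_const {X : Type*} [MeasurableSpace X] (μ ν : Measure X) [IsProbabilityMeasure μ] :
    kAct (Kernel.const X ν) μ = ν := by
  have h := Measure.const_comp (μ := μ) (ν := ν)
  rwa [measure_univ, one_smul] at h

lemma cDelta_nonneg {X Θ : Type*} [MeasurableSpace X] (E F : Θ → Measure X) :
    0 ≤ cDelta E F :=
  Real.iInf_nonneg fun _ => Real.iSup_nonneg fun _ => tvDist_nonneg _ _

lemma cDelta_le {X Θ : Type*} [MeasurableSpace X] (E F : Θ → Measure X) (Λ : Kernel X X)
    [hΛ : IsMarkovKernel Λ] {c : ℝ} (hc : 0 ≤ c) (h : ∀ θ, tvDist (kAct Λ (E θ)) (F θ) ≤ c) :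
    cDelta E F ≤ c := by
  have hbdd : BddBelow (Set.range fun Λ : {κ : Kernel X X // IsMarkovKernel κ} =>
      ⨆ θ, tvDist (kAct Λ.1 (E θ)) (F θ)) :=
    ⟨0, by rintro _ ⟨_, rfl⟩; exact Real.iSup_nonneg fun _ => tvDist_nonneg _ _⟩
  exact (ciInf_le hbdd ⟨Λ, hΛ⟩).trans (Real.iSup_le h hc)

/-- A constant family can only be close to families of small diameter. -/
lemma tvDist_lt_of_cDelta_const_lt {X Θ : Type*} [MeasurableSpace X] (P : Measure X)
    [IsProbabilityMeasure P] (F : Θ → Measure X) [∀ θ, IsProbabilityMeasure (F θ)] {c : ℝ}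
    (h : cDelta (fun _ => P) F < c) (θ θ' : Θ) : tvDist (F θ) (F θ') < c + c := by
  have : Nonempty {κ : Kernel X X // IsMarkovKernel κ} := ⟨⟨Kernel.id, inferInstance⟩⟩
  unfold cDelta at h
  obtain ⟨⟨Λ, hΛ⟩, hlt⟩ := exists_lt_of_ciInf_lt h
  have := isProbabilityMeasure_kAct Λ P
  have hbdd : BddAbove (Set.range fun η => tvDist (kAct Λ P) (F η)) :=
    ⟨2, by rintro _ ⟨_, rfl⟩; exact tvDist_le_two _ _⟩
  have key : ∀ η, tvDist (kAct Λ P) (F η) < c := fun η => (le_ciSup hbdd η).trans_lt hlt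
  calc tvDist (F θ) (F θ') ≤ tvDist (F θ) (kAct Λ P) + tvDist (kAct Λ P) (F θ') :=
        tvDist_triangle _ _ _
    _ < c + c := add_lt_add ((tvDist_comm _ _).trans_lt (key θ)) (key θ')

/-- A classical Markov process is weakly ergodic iff every trajectory of a
family of probability measures converges in `Δ` to the constant family at an
arbitrary fixed probability measure `P*`. -/
theorem classical_weakly_ergodic_iff.{u} {X : Type*} [MeasurableSpace X]
    (κ : ℕ → Kernel X X) (hκ : ∀ i, 1 ≤ i → IsMarkovKernel (κ i))
    (Pstar : MeasureTheory.Measure X) (hPstar : IsProbabilityMeasure Pstar) :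
    Tendsto
      (fun i => ⨆ P : {μ : MeasureTheory.Measure X // IsProbabilityMeasure μ},
        ⨆ P' : {μ : MeasureTheory.Measure X // IsProbabilityMeasure μ},
          tvDist (cIter κ P.1 i) (cIter κ P'.1 i)) atTop (nhds 0) ↔
    ∀ (Θ : Type u) (E : Θ → MeasureTheory.Measure X),
      (∀ θ, IsProbabilityMeasure (E θ)) →
        Tendsto (fun i => cDist (cTraj κ E i) (fun _ : Θ => Pstar)) atTop (nhds 0) := by
  constructor
  · intro h Θ E hE
    refine squeeze_zero (fun i => (cDelta_nonneg _ _).trans (le_max_left _ _)) (fun i => ?_) h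
    have hprob : ∀ (P : {μ : Measure X // IsProbabilityMeasure μ}) (j : ℕ),
        IsProbabilityMeasure (cIter κ P.1 j) := fun P j =>
      have := P.2
      isProbabilityMeasure_cIter hκ P.1 j
    have hle : ∀ P P' : {μ : Measure X // IsProbabilityMeasure μ},
        tvDist (cIter κ P.1 i) (cIter κ P'.1 i) ≤
          ⨆ P : {μ : Measure X // IsProbabilityMeasure μ},
            ⨆ P' : {μ : Measure X // IsProbabilityMeasure μ},
              tvDist (cIter κ P.1 i) (cIter κ P'.1 i) := fun P P' =>
      (le_ciSup (f := fun P' : {μ : Measure X // IsProbabilityMeasure μ} =>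
          tvDist (cIter κ P.1 i) (cIter κ P'.1 i))
        ⟨2, by rintro _ ⟨_, rfl⟩; have := hprob; exact tvDist_le_two _ _⟩ P').trans
      (le_ciSup (f := fun P : {μ : Measure X // IsProbabilityMeasure μ} =>
          ⨆ P' : {μ : Measure X // IsProbabilityMeasure μ},
            tvDist (cIter κ P.1 i) (cIter κ P'.1 i))
        ⟨2, by
          rintro _ ⟨_, rfl⟩
          have := hprob
          exact Real.iSup_le (fun _ => tvDist_le_two _ _) zero_le_two⟩ P)
    have hsup := (tvDist_nonneg _ _).trans (hle ⟨Pstar, hPstar⟩ ⟨Pstar, hPstar⟩)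
    have hstar := hprob ⟨Pstar, hPstar⟩ i
    refine max_le (cDelta_le _ _ (Kernel.const X Pstar) hsup fun θ => ?_)
      (cDelta_le _ _ (Kernel.const X (cIter κ Pstar i)) hsup fun θ => ?_)
    · have := hprob ⟨E θ, hE θ⟩ i
      rw [cTraj_apply, kAct_const]
      simpa [tvDist] using hsup
    · rw [cTraj_apply, kAct_const]
      exact hle ⟨Pstar, hPstar⟩ ⟨E θ, hE θ⟩
  · intro h
    have : Nonempty {μ : Measure X // IsProbabilityMeasure μ} := ⟨⟨Pstar, hPstar⟩⟩
    set D : ℕ → ℝ := fun i => ⨆ P : {μ : Measure X // IsProbabilityMeasure μ},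
      ⨆ P' : {μ : Measure X // IsProbabilityMeasure μ},
        tvDist (cIter κ P.1 i) (cIter κ P'.1 i)
    -- A countable family that nearly attains the supremum at every time is enough.
    have hnear : ∀ i : ℕ, ∃ P P' : {μ : Measure X // IsProbabilityMeasure μ},
        D i - 1 / ((i : ℝ) + 1) < tvDist (cIter κ P.1 i) (cIter κ P'.1 i) := by
      intro i
      have hi : D i - 1 / ((i : ℝ) + 1) < D i := sub_lt_self _ Nat.one_div_pos_of_nat
      obtain ⟨P, hP⟩ := exists_lt_of_lt_ciSup hi
      obtain ⟨P', hP'⟩ := exists_lt_of_lt_ciSup hP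
      exact ⟨P, P', hP'⟩
    choose P P' hPP' using hnear
    let E : ULift.{u} (ℕ × Bool) → Measure X := fun θ =>
      if θ.down.2 then (P θ.down.1).1 else (P' θ.down.1).1
    have hE : ∀ θ, IsProbabilityMeasure (E θ) := by
      rintro ⟨n, _ | _⟩
      exacts [(P' n).2, (P n).2]
    have hEi : ∀ i θ, IsProbabilityMeasure (cTraj κ E i θ) := fun i θ => by
      rw [cTraj_apply]
      have := hE θ
      exact isProbabilityMeasure_cIter hκ _ i
    have hbound : ∀ i, D i ≤
        2 * cDist (cTraj κ E i) (fun _ => Pstar) + 3 * (1 / ((i : ℝ) + 1)) := by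
      intro i
      have hpos : 0 < 1 / ((i : ℝ) + 1) := Nat.one_div_pos_of_nat
      have := hEi i
      have hlt := tvDist_lt_of_cDelta_const_lt Pstar (cTraj κ E i)
        ((le_max_right _ _).trans_lt (lt_add_of_pos_right
          (cDist (cTraj κ E i) (fun _ => Pstar)) hpos)) ⟨i, true⟩ ⟨i, false⟩
      rw [cTraj_apply, cTraj_apply] at hlt
      have hi : D i - 1 / ((i : ℝ) + 1) < tvDist (cIter κ (E ⟨i, true⟩) i)
        (cIter κ (E ⟨i, false⟩) i) := hPP' i
      linarith
    refine squeeze_zero (fun i => Real.iSup_nonneg fun _ => Real.iSup_nonneg fun _ =>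
      tvDist_nonneg _ _) hbound ?_
    simpa using ((h _ E hE).const_mul 2).add
      (tendsto_one_div_add_atTop_nhds_zero_nat.const_mul (3 : ℝ))
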